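/- Let θ be an irrational real number. For ε ∈ (0,4) define T_ε = { l ∈ ℕ, l ≥ 1 : 2 − 2·cos(2π l θ) > ε } and for i ≥ 1 let t(ε, i) = #{ l ∈ T_ε : l < i }. Then limsup_{i→∞} i / t(ε,i) is finite for every ε ∈ (0,4), and lim_{ε→0⁺} limsup_{i→∞} i / t(ε,i) = 1; that is, for every δ > 0 there exists ε₀ > 0 such that for all 0 < ε < ε₀, 1 ≤ limsup_{i→∞} i / t(ε,i) ≤ 1 + δ. (The set of times at which the irrational rotation by θ stays ε-away from 0 has asymptotic density tending to 1 as ε → 0.) -/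

import Mathlib

open scoped ENNReal

lemma aux_syndetic (p : ℕ → Prop) [DecidablePred p] (M : ℕ) (hM : 0 < M)
    (h : ∀ n, ∃ l, n ≤ l ∧ l < n + M ∧ p l) (i : ℕ) : i ≤ M * (Nat.count p i + 1) := by
  induction i using Nat.strong_induction_on with
  | _ i ih =>
    by_cases hi : i < M
    · nlinarith [Nat.zero_le (M * Nat.count p i)]
    · obtain ⟨j, rfl⟩ : ∃ j, i = j + M := ⟨i - M, by omega⟩
      have h1 := ih j (by omega)
      obtain ⟨l, hl1, hl2, hl3⟩ := h j
      have h2 : Nat.count p j ≤ Nat.count p l := Nat.count_monotone p hl1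
      have h3 : Nat.count p (l+1) ≤ Nat.count p (j+M) := Nat.count_monotone p (by omega)
      have h4 : Nat.count p (l+1) = Nat.count p l + 1 := by simp [Nat.count_succ, hl3]
      have h5 : Nat.count p j + 1 ≤ Nat.count p (j+M) := by omega
      nlinarith [Nat.mul_le_mul_left M h5]

lemma aux_sparse (p : ℕ → Prop) [DecidablePred p] (N : ℕ) (hN : 0 < N)
    (h : ∀ a b, a < b → b < a + N → p a → ¬ p b) (i : ℕ) : N * Nat.count p i ≤ i + N := by
  have key : ∀ n m, m ≤ N → Nat.count p (n + m) ≤ Nat.count p n + 1 := by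
    intro n m hm
    rw [Nat.count_add]
    have : Nat.count (fun k => p (n + k)) m ≤ 1 := by
      rw [Nat.count_eq_card_filter_range, Finset.card_le_one]
      intro a ha b hb
      simp only [Finset.mem_filter, Finset.mem_range] at ha hb
      rcases lt_trichotomy a b with hab | hab | hab
      · exact absurd hb.2 (h (n+a) (n+b) (by omega) (by omega) ha.2)
      · exact hab
      · exact absurd ha.2 (h (n+b) (n+a) (by omega) (by omega) hb.2)
    omega
  induction i using Nat.strong_induction_on with
  | _ i ih =>
    by_cases hi : i < N
    · have := key 0 i hi.le
      simp only [zero_add, Nat.count_zero] at this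
      nlinarith [Nat.mul_le_mul_left N this]
    · obtain ⟨j, rfl⟩ : ∃ j, i = j + N := ⟨i - N, by omega⟩
      have h1 := ih j (by omega)
      nlinarith [Nat.mul_le_mul_left N (key j N le_rfl)]

lemma aux_window (θ : ℝ) (hθ : Irrational θ) (ε : ℝ) (hε : ε < 4) :
    ∃ M : ℕ, 0 < M ∧ ∀ n : ℕ, ∃ l : ℕ, n ≤ l ∧ l < n + M ∧
      ε < 2 - 2 * Real.cos (2 * Real.pi * (l : ℝ) * θ) := by
  set g : ℝ → ℝ := fun x => 2 - 2 * Real.cos (2 * Real.pi * x) with hg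
  have hgc : Continuous g := by fun_prop
  have hper : ∀ (x : ℝ) (a : ℤ), g (x + a) = g x := by
    intro x a
    simp only [hg]
    rw [show 2 * Real.pi * (x + a) = 2 * Real.pi * x + a * (2 * Real.pi) by ring,
      Real.cos_add_int_mul_two_pi]
  have hd : Dense (AddSubgroup.closure {1, θ} : Set ℝ) := by
    rw [dense_addSubgroupClosure_pair_iff]
    simpa using hθ
  have hcov : ∀ x : ℝ, ∃ k : ℤ, ε < g (x + k * θ) := by
    intro x
    have ho : IsOpen {y | ε < g (x + y)} := isOpen_lt continuous_const (by fun_prop)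
    obtain ⟨y, hy1, hy2⟩ := hd.exists_mem_open ho ⟨1/2 - x, by
      simp only [Set.mem_ofPred_eq, hg]
      rw [show 2 * Real.pi * (x + (1/2 - x)) = Real.pi by ring, Real.cos_pi]
      linarith⟩
    rw [SetLike.mem_coe, AddSubgroup.mem_closure_pair] at hy1
    obtain ⟨a, b, rfl⟩ := hy1
    refine ⟨b, ?_⟩
    have h2 : ε < g (x + (a • (1:ℝ) + b • θ)) := hy2
    rw [show x + (a • (1:ℝ) + b • θ) = (x + b * θ) + a by simp; ring, hper] at h2
    exact h2
  obtain ⟨T, hT⟩ := (isCompact_Icc (a := (0:ℝ)) (b := 1)).elim_finite_subcover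
    (fun k : ℤ => {x | ε < g (x + k * θ)})
    (fun k => isOpen_lt continuous_const (by fun_prop))
    (fun x _ => by simpa using hcov x)
  obtain ⟨K, hK⟩ : ∃ K : ℕ, ∀ k ∈ T, k.natAbs ≤ K :=
    ⟨T.sup Int.natAbs, fun k hk => Finset.le_sup (f := Int.natAbs) hk⟩
  refine ⟨2 * K + 1, by omega, fun n => ?_⟩
  have hx := hT (show Int.fract (((n + K : ℕ) : ℝ) * θ) ∈ Set.Icc (0:ℝ) 1 from
    ⟨Int.fract_nonneg _, (Int.fract_lt_one _).le⟩)
  simp only [Set.mem_iUnion, Set.mem_ofPred_eq] at hx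
  obtain ⟨k, hk, hx⟩ := hx
  have hk' := hK k hk
  refine ⟨((n:ℤ) + K + k).toNat, by omega, by omega, ?_⟩
  have hc : ((((n:ℤ) + K + k).toNat : ℕ) : ℝ) = n + K + k := by
    have : ((((n:ℤ) + K + k).toNat : ℕ) : ℤ) = n + K + k := Int.toNat_of_nonneg (by omega)
    exact_mod_cast this
  rw [← hper _ ⌊((n + K : ℕ) : ℝ) * θ⌋] at hx
  have he : Int.fract (((n + K : ℕ) : ℝ) * θ) + k * θ + (⌊((n + K : ℕ) : ℝ) * θ⌋ : ℝ)
      = (n + K + k) * θ := by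
    have := Int.fract_add_floor (((n + K : ℕ) : ℝ) * θ)
    push_cast at this ⊢
    linarith
  rw [he] at hx
  rw [hc, mul_assoc]
  exact hx

lemma aux_cos (a b : ℝ) : 2 - 2 * Real.cos (b - a) ≤
    2 * (2 - 2 * Real.cos a) + 2 * (2 - 2 * Real.cos b) := by
  rw [Real.cos_sub]
  nlinarith [Real.sin_sq_add_cos_sq a, Real.sin_sq_add_cos_sq b,
    sq_nonneg (Real.sin a + Real.sin b), sq_nonneg (Real.cos a + Real.cos b - 2)]

lemma aux_pos (θ : ℝ) (hθ : Irrational θ) (k : ℕ) (hk : 0 < k) :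
    0 < 2 - 2 * Real.cos (2 * Real.pi * (k : ℝ) * θ) := by
  have h1 : Real.cos (2 * Real.pi * (k : ℝ) * θ) ≠ 1 := by
    intro h
    rw [Real.cos_eq_one_iff] at h
    obtain ⟨n, hn⟩ := h
    have hp := Real.pi_pos
    have : (n:ℝ) = k * θ := by
      have : (2 * Real.pi) * (n - k * θ) = 0 := by linarith
      rcases mul_eq_zero.1 this with h | h
      · linarith
      · linarith
    exact (hθ.natCast_mul hk.ne').ne_int n this.symm
  have := lt_of_le_of_ne (Real.cos_le_one _) h1
  linarith

lemma aux_min (f : ℕ → ℝ) (hf : ∀ k, 0 < k → 0 < f k) (N : ℕ) :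
    ∃ c : ℝ, 0 < c ∧ ∀ k, 0 < k → k < N → c ≤ f k := by
  induction N with
  | zero => exact ⟨1, one_pos, by omega⟩
  | succ n ih =>
    obtain ⟨c, hc, h⟩ := ih
    by_cases hn : n = 0
    · exact ⟨1, one_pos, by omega⟩
    · refine ⟨min c (f n), lt_min hc (hf n (by omega)), fun k hk hk' => ?_⟩
      rcases Nat.lt_succ_iff_lt_or_eq.1 hk' with h1 | rfl
      · exact (min_le_left _ _).trans (h k hk h1)
      · exact min_le_right _ _

/-- for an irrational rotation by `θ`, the set of times staying `ε`-away from `0`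
has counting function `t(ε,i)` with `limsup_i i/t(ε,i)` finite for `ε ∈ (0,4)`, and
`limsup_i i/t(ε,i) → 1` as `ε → 0⁺` (division in `ℝ≥0∞`, so `i/0 = ∞`). -/
theorem stmt19 (θ : ℝ) (hθ : Irrational θ)
    (t : ℝ → ℕ → ℕ)
    (ht : t = fun ε i => ((Finset.range i).filter
      (fun l : ℕ => 1 ≤ l ∧ ε < 2 - 2 * Real.cos (2 * Real.pi * (l : ℝ) * θ))).card)
    (L : ℝ → ℝ≥0∞)
    (hL : L = fun ε => Filter.limsup (fun i : ℕ => (i : ℝ≥0∞) / (t ε i : ℝ≥0∞)) Filter.atTop) :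
    (∀ ε ∈ Set.Ioo (0 : ℝ) 4, L ε < ⊤) ∧
    (∀ δ : ℝ, 0 < δ → ∃ ε₀ : ℝ, 0 < ε₀ ∧ ∀ ε : ℝ, 0 < ε → ε < ε₀ →
      1 ≤ L ε ∧ L ε ≤ 1 + ENNReal.ofReal δ) := by
  classical
  have htc : ∀ ε i, 0 < ε → t ε i =
      Nat.count (fun l : ℕ => ε < 2 - 2 * Real.cos (2 * Real.pi * (l : ℝ) * θ)) i := by
    intro ε i hε
    rw [ht, Nat.count_eq_card_filter_range]
    dsimp only
    congr 1
    apply Finset.filter_congr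
    intro l _
    refine ⟨fun h => h.2, fun h => ⟨?_, h⟩⟩
    by_contra h0
    have : l = 0 := by omega
    subst this
    simp at h
    linarith
  constructor
  · rintro ε ⟨h0, h4⟩
    obtain ⟨M, hM, hw⟩ := aux_window θ hθ ε h4
    have hb := aux_syndetic _ M hM hw
    rw [hL]
    refine lt_of_le_of_lt (b := ((2 * M : ℕ) : ℝ≥0∞)) ?_ (ENNReal.natCast_lt_top _)
    refine Filter.limsup_le_of_le (by isBoundedDefault) ?_
    filter_upwards [Filter.eventually_ge_atTop (M + 1)] with i hi
    have hbi := hb i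
    rw [← htc ε i h0] at hbi
    have ht1 : 1 ≤ t ε i := by
      by_contra h
      have : t ε i = 0 := by omega
      rw [this] at hbi
      omega
    apply ENNReal.div_le_of_le_mul
    have : i ≤ 2 * M * t ε i := by nlinarith [Nat.mul_le_mul_left M ht1]
    exact_mod_cast this
  · intro δ hδ
    obtain ⟨N, hN⟩ := exists_nat_ge (2 * (1 + δ) / δ)
    have hN0 : (0:ℝ) < N := lt_of_lt_of_le (by positivity) hN
    have hN0' : 0 < N := by exact_mod_cast hN0
    obtain ⟨c, hc, hcm⟩ := aux_min _ (aux_pos θ hθ) N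
    refine ⟨c / 4, by positivity, fun ε h0 hε => ⟨?_, ?_⟩⟩
    · rw [hL]
      apply Filter.le_limsup_of_frequently_le _ (by isBoundedDefault)
      apply Filter.Eventually.frequently
      filter_upwards [Filter.eventually_ge_atTop 1] with i hi
      have hti : t ε i ≤ i := by
        rw [htc ε i h0]; exact Nat.count_le _
      rw [ENNReal.le_div_iff_mul_le (Or.inr (by exact_mod_cast (by omega : i ≠ 0)))
        (Or.inl (ENNReal.natCast_ne_top _)), one_mul]
      exact_mod_cast hti
    · have hs := aux_sparse
        (fun l : ℕ => ¬ (ε < 2 - 2 * Real.cos (2 * Real.pi * (l : ℝ) * θ))) N hN0' (by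
          intro a b hab hbN ha hb
          have h1 := hcm (b - a) (by omega) (by omega)
          have h2 := aux_cos (2 * Real.pi * (a : ℝ) * θ) (2 * Real.pi * (b : ℝ) * θ)
          rw [Nat.cast_sub hab.le, show 2 * Real.pi * ((b:ℝ) - a) * θ =
            2 * Real.pi * (b : ℝ) * θ - 2 * Real.pi * (a : ℝ) * θ by ring] at h1
          linarith)
      rw [hL]
      refine Filter.limsup_le_of_le (by isBoundedDefault) ?_
      obtain ⟨I, hI⟩ := exists_nat_ge (2 * (1 + δ) / δ)
      filter_upwards [Filter.eventually_ge_atTop I] with i hi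
      have hsi := hs i
      have hsum : t ε i + Nat.count
          (fun l : ℕ => ¬ (ε < 2 - 2 * Real.cos (2 * Real.pi * (l : ℝ) * θ))) i = i := by
        rw [htc ε i h0, Nat.count_eq_card_filter_range, Nat.count_eq_card_filter_range,
          Finset.card_filter_add_card_filter_not, Finset.card_range]
      generalize Nat.count
          (fun l : ℕ => ¬ (ε < 2 - 2 * Real.cos (2 * Real.pi * (l : ℝ) * θ))) i = B at hsi hsum
      generalize t ε i = T at hsum ⊢
      apply ENNReal.div_le_of_le_mul
      have hsi' : (N:ℝ) * B ≤ i + N := by exact_mod_cast hsi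
      have hsum' : (T:ℝ) + B = i := by exact_mod_cast hsum
      have hi' : 2 * (1 + δ) / δ ≤ (i:ℝ) := hI.trans (by exact_mod_cast hi)
      rw [div_le_iff₀ hδ] at hN hi'
      have hreal : (i:ℝ) ≤ (1 + δ) * T := by
        have hB : (1 + δ) * B ≤ δ * i := by
          have e1 : (1 + δ) * (N * B) ≤ (1 + δ) * (i + N) :=
            mul_le_mul_of_nonneg_left hsi' (by positivity)
          have e2 := mul_le_mul_of_nonneg_right hN (Nat.cast_nonneg (α := ℝ) i)
          have e3 := mul_le_mul_of_nonneg_right hi' hN0.le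
          have e4 : (N:ℝ) * ((1 + δ) * B) ≤ N * (δ * i) := by nlinarith
          exact le_of_mul_le_mul_left e4 hN0
        nlinarith
      have h3 := ENNReal.ofReal_le_ofReal hreal
      rw [ENNReal.ofReal_mul (by positivity), ENNReal.ofReal_natCast, ENNReal.ofReal_natCast,
        ENNReal.ofReal_add zero_le_one hδ.le, ENNReal.ofReal_one] at h3
      exact h3
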